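/- Let 𝔤 be a Lie algebra over k, let p ≥ 1, q ≥ 0, r ≥ 1, and let x_1,…,x_{p+q}, y_1,…,y_r ∈ 𝔤. Then B_p(y_1⋯y_r, x_1⋯x_{p+q}) = Σ_{k=0}^{r-1} c_k(q) · Σ_{S ⊂ {1,…,p+q}, #S = q+k} x_S · B_p(y_1⋯y_r, x_{S^c}), where S^c denotes the complement of S in {1,…,p+q}. -/

import Mathlib

noncomputable section

/-- The degree-`n` homogeneous component `S^n` of the symmetric algebra:
the span of `n`-fold products of elements of `𝔤` (realized as the `n`-th power of the
submodule `ι(𝔤) ⊆ S`). -/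
def Sdeg (k : Type) [Field k] (L : Type) [LieRing L] [LieAlgebra k L]
    (S : Type) [CommRing S] [Algebra k S] (ι : L →ₗ[k] S) (n : ℕ) : Submodule k S :=
  (LinearMap.range ι) ^ n

/-- `(S, ι)` is a model of the symmetric algebra of the Lie algebra `L`:
`S` is commutative and generated as a `k`-algebra by the image of `ι`. -/
def IsSymmAlg (k : Type) [Field k] (L : Type) [LieRing L] [LieAlgebra k L]
    (S : Type) [CommRing S] [Algebra k S] (ι : L →ₗ[k] S) : Prop :=
  Algebra.adjoin k (Set.range ι) = ⊤

/-- `e : S → U𝔤` is the symmetrization map: it sends a monomial `g₁ ⋯ g_p` to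
`(1/p!) ∑_{σ ∈ S_p} g_{σ(1)} ⋯ g_{σ(p)}`. -/
def IsSymmetrization (k : Type) [Field k] (L : Type) [LieRing L] [LieAlgebra k L]
    (S : Type) [CommRing S] [Algebra k S] (ι : L →ₗ[k] S)
    (e : S →ₗ[k] UniversalEnvelopingAlgebra k L) : Prop :=
  ∀ l : List L,
    e (l.map ι).prod = ((l.length.factorial : k)⁻¹) •
      ∑ σ : Equiv.Perm (Fin l.length),
        (List.ofFn fun i => UniversalEnvelopingAlgebra.ι k (l.get (σ i))).prod

/-- `B : ℕ → S →ₗ S →ₗ S` is the family of homogeneous components `B_p` of the product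
`B(x,y) = e⁻¹(e(x)e(y))`: each `B p` lowers total degree by `p` (it maps `S^n ⊗ S^m`
to `S^{n+m-p}` and vanishes for `p > n+m`), and on homogeneous elements `x ∈ S^n`,
`y ∈ S^m` one has `e (∑_{p=0}^{n+m} B p x y) = e x * e y`, i.e.
`e⁻¹(e(x)e(y)) = ∑_p B_p(x,y)`. -/
def IsPBWComponents (k : Type) [Field k] (L : Type) [LieRing L] [LieAlgebra k L]
    (S : Type) [CommRing S] [Algebra k S] (ι : L →ₗ[k] S)
    (e : S →ₗ[k] UniversalEnvelopingAlgebra k L)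
    (B : ℕ → S →ₗ[k] S →ₗ[k] S) : Prop :=
  (∀ p n m, ∀ x ∈ Sdeg k L S ι n, ∀ y ∈ Sdeg k L S ι m,
      B p x y ∈ Sdeg k L S ι (n + m - p)) ∧
  (∀ p n m, n + m < p → ∀ x ∈ Sdeg k L S ι n, ∀ y ∈ Sdeg k L S ι m, B p x y = 0) ∧
  (∀ n m, ∀ x ∈ Sdeg k L S ι n, ∀ y ∈ Sdeg k L S ι m,
      e (∑ p ∈ Finset.range (n + m + 1), B p x y) = e x * e y)


/-- The rational numbers `c_k(q)` of the paper, defined recursively by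
`c_0(q) = 1` and `c_k(q) = 1 - ∑_{l=0}^{k-1} c_l(q) * (q+k).choose (k-l)` for `k ≥ 1`.
Here `paperC q k` denotes `c_k(q)`. -/
def paperC (q : ℕ) : ℕ → ℚ
  | 0 => 1
  | (k + 1) =>
      1 - ∑ l : Fin (k + 1), paperC q l * ((q + (k + 1)).choose ((k + 1) - l))
  termination_by k => k
  decreasing_by exact l.isLt

theorem coeff_mem_of_forall_sum_pow_smul_mem {K V : Type*} [Field K] [Infinite K]
    [AddCommGroup V] [Module K V] (W : Submodule K V) (N : ℕ) (f : ℕ → V)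
    (h : ∀ a : K, ∑ i ∈ Finset.range N, a ^ i • f i ∈ W) {i : ℕ} (hi : i < N) : f i ∈ W := by
  by_contra hf
  obtain ⟨φ, hφ, hW⟩ := Submodule.exists_le_ker_of_notMem hf
  apply hφ
  have hp : (∑ j ∈ Finset.range N, Polynomial.monomial j (φ (f j))) = 0 := by
    refine Polynomial.funext fun a => ?_
    have := hW (h a)
    simp only [LinearMap.mem_ker, map_sum, map_smul, smul_eq_mul] at this
    simpa [Polynomial.eval_finsetSum, mul_comm] using this
  have := congrArg (fun q => Polynomial.coeff q i) hp
  simpa [Polynomial.finsetSum_coeff, Polynomial.coeff_monomial, hi] using this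

theorem list_prod_mem_of_forall_pow_mem {K V M : Type*} [Field K] [CharZero K]
    [AddCommGroup V] [Module K V] [AddCommGroup M] [Module K M]
    (W : Submodule K V) (F : M →ₗ[K] Module.End K V) (hF : ∀ x y, Commute (F x) (F y))
    (v : V) (N : ℕ) (h : ∀ x, (F x ^ N) v ∈ W) (l : List M) (hl : l.length = N) :
    (l.map F).prod v ∈ W := by
  suffices H : ∀ (l : List M) (n : ℕ) (x : M), n + l.length = N →
      (F x ^ n * (l.map F).prod) v ∈ W by
    simpa using H l 0 0 (by simpa using hl)
  intro l
  induction l with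
  | nil => rintro n x rfl; simpa using h x
  | cons z l ih =>
    intro n x hn
    have key := coeff_mem_of_forall_sum_pow_smul_mem W (n + 2)
      (fun m => (F z ^ m * F x ^ (n + 1 - m) * ((n + 1).choose m : Module.End K V) *
        (l.map F).prod) v) (fun a => by
        have := ih (n + 1) (a • z + x) (by simp at hn; omega)
        rw [map_add, map_smul, ((hF z x).smul_left a).add_pow, Finset.sum_mul,
          LinearMap.sum_apply] at this
        simpa [smul_pow, smul_mul_assoc] using this) (i := 1) (by omega)
    have hc : (F z * F x ^ n * ((n + 1 : ℕ) : Module.End K V) * (l.map F).prod) v =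
        ((n + 1 : ℕ) : K) • (F x ^ n * ((z :: l).map F).prod) v := by
      rw [((hF z x).pow_right n).eq]
      simp only [Module.End.mul_apply, Module.End.natCast_apply, map_nsmul,
        Nat.cast_smul_eq_nsmul, List.map_cons, List.prod_cons]
    simp only [pow_one, Nat.add_sub_cancel, Nat.choose_one_right] at key
    rw [hc] at key
    exact (W.smul_mem_iff (Nat.cast_ne_zero.2 n.succ_ne_zero)).1 key

section SymmetricAlgebraModel

variable {k L S : Type} [Field k] [LieRing L] [LieAlgebra k L] [CommRing S] [Algebra k S]
  {ι : L →ₗ[k] S}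

open scoped Pointwise in
theorem Sdeg_eq_span (n : ℕ) :
    Sdeg k L S ι n = Submodule.span k {w | ∃ l : List L, l.length = n ∧ (l.map ι).prod = w} := by
  have h1 : LinearMap.range ι = Submodule.span k (Set.range ι) := by
    rw [← LinearMap.coe_range, Submodule.span_eq]
  rw [Sdeg, h1, Submodule.span_pow]
  congr 1
  ext w
  induction n generalizing w with
  | zero => simp [List.length_eq_zero_iff, eq_comm]
  | succ n ih =>
    simp only [pow_succ', Set.mem_mul, ih, Set.mem_ofPred_eq]
    constructor
    · rintro ⟨_, ⟨x, rfl⟩, _, ⟨l, hl, rfl⟩, rfl⟩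
      exact ⟨x :: l, by simp [hl], by simp⟩
    · rintro ⟨_ | ⟨x, l⟩, hl, rfl⟩
      · simp at hl
      · exact ⟨ι x, ⟨x, rfl⟩, _, ⟨l, by simpa using hl, rfl⟩, by simp⟩

theorem list_prod_mem_Sdeg (l : List L) : (l.map ι).prod ∈ Sdeg k L S ι l.length := by
  rw [Sdeg_eq_span]
  exact Submodule.subset_span ⟨l, rfl, rfl⟩

theorem mul_mem_Sdeg_succ (x : L) {n : ℕ} {w : S} (hw : w ∈ Sdeg k L S ι n) :
    ι x * w ∈ Sdeg k L S ι (n + 1) := by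
  rw [Sdeg, pow_succ']
  exact Submodule.mul_mem_mul ⟨x, rfl⟩ hw

theorem one_mem_Sdeg_zero : (1 : S) ∈ Sdeg k L S ι 0 := by
  rw [Sdeg, pow_zero]
  exact Submodule.one_le.1 le_rfl

theorem prod_mem_Sdeg {n : ℕ} (y : Fin n → L) : ∏ j, ι (y j) ∈ Sdeg k L S ι n := by
  have := list_prod_mem_Sdeg (ι := ι) (List.ofFn y)
  simpa [List.prod_ofFn, List.map_ofFn] using this

theorem Sdeg_le_span_pow [CharZero k] (n : ℕ) :
    Sdeg k L S ι n ≤ Submodule.span k (Set.range fun x => ι x ^ n) := by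
  rw [Sdeg_eq_span, Submodule.span_le]
  rintro _ ⟨l, hl, rfl⟩
  have := list_prod_mem_of_forall_pow_mem (Submodule.span k (Set.range fun x => ι x ^ n))
    (LinearMap.mul k S ∘ₗ ι) (fun x y => LinearMap.ext fun w => mul_left_comm _ _ _) 1 n
    (fun x => by
      have : (LinearMap.mul k S ∘ₗ ι) x ^ n = LinearMap.mulLeft k (ι x ^ n) :=
        LinearMap.pow_mulLeft k S (ι x) n
      rw [this]
      exact Submodule.subset_span ⟨x, (mul_one _).symm⟩) l hl
  have hprod : ∀ l : List L, (l.map (LinearMap.mul k S ∘ₗ ι)).prod 1 = (l.map ι).prod := by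
    intro l
    induction l with
    | nil => simp
    | cons x l ih => simp only [List.map_cons, List.prod_cons, Module.End.mul_apply, ih]; rfl
  rwa [hprod] at this

/-- The commutator of an endomorphism of `S` with multiplication by `ι x`. -/
def mulCommutator (ι : L →ₗ[k] S) : L →ₗ[k] Module.End k (Module.End k S) :=
  LinearMap.mk₂ k (fun x A => A * LinearMap.mul k S (ι x) - LinearMap.mul k S (ι x) * A)
    (fun x y A => by simp only [map_add, mul_add, add_mul]; abel)
    (fun c x A => by simp only [map_smul, mul_smul_comm, smul_mul_assoc, smul_sub])
    (fun x A A' => by simp only [mul_add, add_mul]; abel)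
    (fun c x A => by simp only [mul_smul_comm, smul_mul_assoc, smul_sub])

@[simp]
theorem mulCommutator_apply (x : L) (A : Module.End k S) (w : S) :
    mulCommutator ι x A w = A (ι x * w) - ι x * A w := rfl

theorem mulCommutator_commute (x y : L) : Commute (mulCommutator ι x) (mulCommutator ι y) := by
  refine LinearMap.ext fun A => LinearMap.ext fun w => ?_
  simp only [Module.End.mul_apply, mulCommutator_apply, mul_left_comm (ι x) (ι y)]
  ring

instance : LeftCommutative fun (x : L) (Φ : Module.End k (Module.End k S)) =>
    mulCommutator ι x * Φ :=
  ⟨fun x y Φ => by rw [← mul_assoc, (mulCommutator_commute x y).eq, mul_assoc]⟩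

/-- The iterated commutator with multiplication by the elements of a multiset. -/
def iterCommutator (ι : L →ₗ[k] S) (s : Multiset L) : Module.End k (Module.End k S) :=
  s.foldr (fun x Φ => mulCommutator ι x * Φ) 1

@[simp]
theorem iterCommutator_zero : iterCommutator ι (0 : Multiset L) = 1 := rfl

theorem iterCommutator_cons (x : L) (s : Multiset L) (A : Module.End k S) :
    iterCommutator ι (x ::ₘ s) A = mulCommutator ι x (iterCommutator ι s A) := by
  simp [iterCommutator]

theorem iterCommutator_cons' (x : L) (s : Multiset L) (A : Module.End k S) :
    iterCommutator ι (x ::ₘ s) A = iterCommutator ι s (mulCommutator ι x A) := by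
  induction s using Multiset.induction_on generalizing A with
  | empty => rw [iterCommutator_cons]; rfl
  | cons y s ih =>
    rw [Multiset.cons_swap, iterCommutator_cons, ih, iterCommutator_cons]

theorem iterCommutator_coe (l : List L) :
    iterCommutator ι (l : Multiset L) = (l.map (mulCommutator ι)).prod := by
  induction l with
  | nil => rfl
  | cons x l ih =>
    ext1 A
    rw [← Multiset.cons_coe, iterCommutator_cons, ih]
    simp

theorem apply_prod_mul_eq_sum_iterCommutator {σ : Type*} [DecidableEq σ] (x : σ → L)
    (T : Finset σ) (A : Module.End k S) (w : S) :
    A ((∏ i ∈ T, ι (x i)) * w) =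
      ∑ V ∈ T.powerset, (∏ i ∈ T \ V, ι (x i)) * iterCommutator ι (V.val.map x) A w := by
  induction T using Finset.induction_on generalizing A with
  | empty => simp
  | insert a T ha ih =>
    have h : A ((∏ i ∈ insert a T, ι (x i)) * w) =
        ι (x a) * A ((∏ i ∈ T, ι (x i)) * w) +
          mulCommutator ι (x a) A ((∏ i ∈ T, ι (x i)) * w) := by
      rw [Finset.prod_insert ha, mulCommutator_apply, mul_assoc]; ring
    rw [h, ih, ih, Finset.sum_powerset_insert ha, Finset.mul_sum]
    congr 1 <;> refine Finset.sum_congr rfl fun V hV => ?_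
    · have haV : a ∉ V := fun h => ha (Finset.mem_powerset.1 hV h)
      rw [Finset.insert_sdiff_of_notMem _ haV, Finset.prod_insert (by simp [ha]), mul_assoc]
    · have haV : a ∉ V := fun h => ha (Finset.mem_powerset.1 hV h)
      rw [Finset.insert_val_of_notMem haV, Multiset.map_cons, iterCommutator_cons']
      congr 2
      ext i
      simp only [Finset.mem_sdiff, Finset.mem_insert]
      constructor
      · rintro ⟨h1, h2⟩
        exact ⟨Or.inr h1, by rintro (rfl | h); exacts [ha h1, h2 h]⟩
      · rintro ⟨rfl | h1, h2⟩
        · simp at h2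
        · exact ⟨h1, fun h => h2 (Or.inr h)⟩

theorem iterCommutator_apply_eq_zero {C : Module.End k S} {M : ℕ}
    (hC : ∀ m ≤ M, ∀ w ∈ Sdeg k L S ι m, C w = 0) (s : Multiset L) {m : ℕ}
    (hm : m + s.card ≤ M) {w : S} (hw : w ∈ Sdeg k L S ι m) : iterCommutator ι s C w = 0 := by
  induction s using Multiset.induction_on generalizing m w with
  | empty => exact hC m (by simpa using hm) w hw
  | cons x s ih =>
    rw [Multiset.card_cons] at hm
    rw [iterCommutator_cons, mulCommutator_apply, ih (by omega) hw,
      ih (by omega) (mul_mem_Sdeg_succ x hw)]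
    simp

theorem iterCommutator_apply_mem_Sdeg {C : Module.End k S} {r p : ℕ}
    (hC : ∀ m, ∀ w ∈ Sdeg k L S ι m, C w ∈ Sdeg k L S ι (r + m - p))
    (hC0 : ∀ m, r + m < p → ∀ w ∈ Sdeg k L S ι m, C w = 0) (s : Multiset L) {m : ℕ}
    {w : S} (hw : w ∈ Sdeg k L S ι m) :
    iterCommutator ι s C w ∈ Sdeg k L S ι (r + m + s.card - p) := by
  induction s using Multiset.induction_on generalizing m w with
  | empty => exact hC m w hw
  | cons x s ih =>
    rw [iterCommutator_cons, mulCommutator_apply, Multiset.card_cons]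
    have h1 := ih (mul_mem_Sdeg_succ x hw)
    rw [show r + (m + 1) + s.card - p = r + m + (s.card + 1) - p by omega] at h1
    refine sub_mem h1 ?_
    by_cases hlt : r + m + s.card < p
    · rw [iterCommutator_apply_eq_zero (M := m + s.card)
        (fun m' hm' => hC0 m' (by omega)) s le_rfl hw]
      simp
    · have h2 := mul_mem_Sdeg_succ x (ih hw)
      rwa [show r + m + s.card - p + 1 = r + m + (s.card + 1) - p by omega] at h2



/-- The elements of degree at most `m`. -/
def Sfil (ι : L →ₗ[k] S) (m : ℕ) : Submodule k S :=
  Submodule.span k {w | ∃ l : List L, l.length ≤ m ∧ (l.map ι).prod = w}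

theorem Sfil_mono {m n : ℕ} (h : m ≤ n) : Sfil ι m ≤ Sfil ι n :=
  Submodule.span_mono fun _ ⟨l, hl, hw⟩ => ⟨l, hl.trans h, hw⟩

theorem Sdeg_le_Sfil (n : ℕ) : Sdeg k L S ι n ≤ Sfil ι n := by
  rw [Sdeg_eq_span]
  exact Submodule.span_mono fun _ ⟨l, hl, hw⟩ => ⟨l, hl.le, hw⟩

theorem mul_mem_Sfil {m n : ℕ} {v w : S} (hv : v ∈ Sfil ι m) (hw : w ∈ Sfil ι n) :
    v * w ∈ Sfil ι (m + n) := by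
  have h := Submodule.mul_mem_mul hv hw
  rw [Sfil, Sfil, Submodule.span_mul_span] at h
  refine Submodule.span_mono ?_ h
  rintro _ ⟨_, ⟨l, hl, rfl⟩, _, ⟨l', hl', rfl⟩, rfl⟩
  exact ⟨l ++ l', by rw [List.length_append]; omega, by simp⟩

theorem ι_mem_Sfil_one (x : L) : ι x ∈ Sfil ι 1 :=
  Submodule.subset_span ⟨[x], by simp, by simp⟩

theorem exists_homogeneous_of_mem_Sfil {m : ℕ} {w : S} (hw : w ∈ Sfil ι m) :
    ∃ v : ℕ → S, (∀ i, v i ∈ Sdeg k L S ι i) ∧ (∀ i, m < i → v i = 0) ∧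
      ∀ N, m < N → ∑ i ∈ Finset.range N, v i = w := by
  induction hw using Submodule.span_induction with
  | mem w h =>
    obtain ⟨l, hl, rfl⟩ := h
    refine ⟨fun i => if i = l.length then (l.map ι).prod else 0, fun i => ?_, fun i hi => ?_,
      fun N hN => ?_⟩
    · dsimp only
      split_ifs with h
      · exact h ▸ list_prod_mem_Sdeg l
      · exact zero_mem _
    · exact if_neg (by omega)
    · rw [Finset.sum_ite_eq', if_pos (by simp; omega)]
  | zero => exact ⟨0, fun i => zero_mem _, fun _ _ => rfl, fun N _ => by simp⟩
  | add w w' _ _ h h' =>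
    obtain ⟨v, h1, h2, h3⟩ := h
    obtain ⟨v', h1', h2', h3'⟩ := h'
    refine ⟨v + v', fun i => add_mem (h1 i) (h1' i), fun i hi => ?_, fun N hN => ?_⟩
    · simp [h2 i hi, h2' i hi]
    · simp [Finset.sum_add_distrib, h3 N hN, h3' N hN]
  | smul c w _ h =>
    obtain ⟨v, h1, h2, h3⟩ := h
    refine ⟨c • v, fun i => Submodule.smul_mem _ c (h1 i), fun i hi => ?_, fun N hN => ?_⟩
    · simp [h2 i hi]
    · simp [← Finset.smul_sum, h3 N hN]

/-- The endomorphisms of `S` all of whose iterated commutators with multiplications by elements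
of `L` raise the degree by at most `r`. -/
def opOrder (ι : L →ₗ[k] S) (r : ℕ) : Submodule k (Module.End k S) where
  carrier := {A | ∀ (s : Multiset L) (m : ℕ), ∀ w ∈ Sfil ι m,
    iterCommutator ι s A w ∈ Sfil ι (m + r)}
  add_mem' hA hB s m w hw := by
    rw [map_add]; exact add_mem (hA s m w hw) (hB s m w hw)
  zero_mem' s m w _ := by rw [map_zero]; exact zero_mem _
  smul_mem' c A hA s m w hw := by
    rw [map_smul]; exact Submodule.smul_mem _ c (hA s m w hw)

theorem mulCommutator_mem_opOrder (x : L) {r : ℕ} {A : Module.End k S} (hA : A ∈ opOrder ι r) :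
    mulCommutator ι x A ∈ opOrder ι r := fun s m w hw => by
  rw [← iterCommutator_cons']; exact hA _ m w hw

theorem mulCommutator_mul (x : L) (A B : Module.End k S) :
    mulCommutator ι x (A * B) = mulCommutator ι x A * B + A * mulCommutator ι x B := by
  ext w
  simp

theorem mul_mem_opOrder {r r' : ℕ} {A B : Module.End k S} (hA : A ∈ opOrder ι r)
    (hB : B ∈ opOrder ι r') : A * B ∈ opOrder ι (r + r') := by
  intro s
  induction s using Multiset.induction_on generalizing A B with
  | empty =>
    intro m w hw
    have := hA 0 _ _ (hB 0 m w hw)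
    rwa [add_assoc, add_comm r' r] at this
  | cons x s ih =>
    intro m w hw
    rw [iterCommutator_cons', mulCommutator_mul, map_add]
    exact add_mem (ih (mulCommutator_mem_opOrder x hA) hB m w hw)
      (ih hA (mulCommutator_mem_opOrder x hB) m w hw)

theorem one_mem_opOrder : (1 : Module.End k S) ∈ opOrder ι 0 := by
  intro s m w hw
  induction s using Multiset.induction_on with
  | empty => exact hw
  | cons x s =>
    have : mulCommutator ι x (1 : Module.End k S) = 0 := by ext w; simp
    rw [iterCommutator_cons', this, map_zero]
    exact zero_mem _

theorem pow_mem_opOrder {A : Module.End k S} (hA : A ∈ opOrder ι 1) (n : ℕ) :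
    A ^ n ∈ opOrder ι n := by
  induction n with
  | zero => exact one_mem_opOrder
  | succ n ih => rw [pow_succ]; exact mul_mem_opOrder ih hA

theorem mem_opOrder_of_iterCommutator_one {A : Module.End k S} {r : ℕ}
    (hA : ∀ s, iterCommutator ι s A 1 ∈ Sfil ι r) : A ∈ opOrder ι r := by
  have key : ∀ (l : List L) (C : Module.End k S),
      (∀ s, iterCommutator ι s C 1 ∈ Sfil ι r) → C (l.map ι).prod ∈ Sfil ι (l.length + r) := by
    intro l
    induction l with
    | nil => intro C hC; simpa using hC 0
    | cons x l ih =>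
      intro C hC
      have h : C (ι x * (l.map ι).prod) =
          ι x * C (l.map ι).prod + mulCommutator ι x C (l.map ι).prod := by simp
      rw [List.map_cons, List.prod_cons, h, List.length_cons]
      refine add_mem ?_ (Sfil_mono (by omega) (ih _ fun s => ?_))
      · have := mul_mem_Sfil (ι_mem_Sfil_one x) (ih C hC)
        rwa [show 1 + (l.length + r) = l.length + 1 + r by omega] at this
      · rw [← iterCommutator_cons']; exact hC _
  intro s m w hw
  induction hw using Submodule.span_induction with
  | mem w h =>
    obtain ⟨l, hl, rfl⟩ := h
    refine Sfil_mono (by omega) (key l _ fun t => ?_)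
    suffices h : iterCommutator ι t (iterCommutator ι s A) = iterCommutator ι (s + t) A by
      rw [h]; exact hA _
    induction s using Multiset.induction_on generalizing A with
    | empty => simp
    | cons x s ih =>
      rw [Multiset.cons_add, iterCommutator_cons', iterCommutator_cons', ih]
      intro u
      rw [← iterCommutator_cons']; exact hA _
  | zero => rw [map_zero]; exact zero_mem _
  | add w w' _ _ h h' => rw [map_add]; exact add_mem h h'
  | smul c w _ h => rw [map_smul]; exact Submodule.smul_mem _ c h

theorem iterCommutator_one_mem_of_replicate [CharZero k] (W : Submodule k S)
    {A : Module.End k S}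
    (h : ∀ (n : ℕ) (x : L), iterCommutator ι (Multiset.replicate n x) A 1 ∈ W)
    (s : Multiset L) : iterCommutator ι s A 1 ∈ W := by
  induction s using Quotient.inductionOn with
  | _ l =>
    have := list_prod_mem_of_forall_pow_mem
      (W.comap (LinearMap.applyₗ (1 : S) : Module.End k S →ₗ[k] S)) (mulCommutator ι)
      mulCommutator_commute A l.length (fun x => by
        have := h l.length x
        rwa [← Multiset.coe_replicate, iterCommutator_coe, List.map_replicate,
          List.prod_replicate] at this) l rfl
    rw [← iterCommutator_coe] at this
    exact this

/-- If `A` acts on the powers of `x` by a binomial formula, then its iterated commutators with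
multiplication by `x` pick out the coefficients. -/
theorem iterCommutator_replicate_one {A : Module.End k S} (x : L) (β : ℕ → S)
    (h : ∀ n, A (ι x ^ n) =
      ∑ ij ∈ Finset.HasAntidiagonal.antidiagonal n,
        (n.choose ij.1 : S) * (β ij.1 * ι x ^ ij.2)) (n : ℕ) :
    iterCommutator ι (Multiset.replicate n x) A 1 = β n := by
  induction n generalizing A β with
  | zero => simpa using h 0
  | succ n ih =>
    rw [Multiset.replicate_succ, iterCommutator_cons']
    refine ih (fun i => β (i + 1)) fun n => ?_
    rw [mulCommutator_apply, ← pow_succ', h, h,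
      Finset.sum_antidiagonal_choose_succ_mul (fun i j => β i * ι x ^ j), Finset.mul_sum,
      sub_eq_iff_eq_add, add_comm]
    congr 1 <;> refine Finset.sum_congr rfl fun ij hij => ?_
    · rw [Nat.choose_symm_of_eq_add (Finset.HasAntidiagonal.mem_antidiagonal.1 hij).symm]
    · ring


theorem exists_pow_add_smul_coeff {A : Type*} [Ring A] [Algebra k A] (X Z : A) (t : ℕ → A)
    (t0 : t 0 = 0) (ts : ∀ n, t (n + 1) = X * t n + Z * X ^ n) (N : ℕ) :
    ∃ h : ℕ → A, h 1 = t N ∧ h 0 = X ^ N ∧ (∀ i, N < i → h i = 0) ∧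
      ∀ a : k, (a • Z + X) ^ N = ∑ i ∈ Finset.range (N + 1), a ^ i • h i := by
  induction N with
  | zero => exact ⟨fun i => if i = 0 then 1 else 0, by simp [t0], by simp,
      fun i hi => if_neg hi.ne', fun a => by simp⟩
  | succ N ih =>
    obtain ⟨h, h1, h0, hz, hs⟩ := ih
    refine ⟨fun i => X * h i + Z * (if i = 0 then 0 else h (i - 1)), ?_, ?_, fun i hi => ?_,
      fun a => ?_⟩
    · simp [h1, h0, ts]
    · simp [h0, pow_succ']
    · simp [hz i (by omega), hz (i - 1) (by omega)]
    · rw [pow_succ', hs, add_mul]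
      simp only [smul_add, Finset.sum_add_distrib]
      rw [add_comm, Finset.sum_range_succ (fun i => a ^ i • (X * h i)), hz (N + 1) (by omega),
        Finset.sum_range_succ' (fun i => a ^ i • (Z * (if i = 0 then 0 else h (i - 1)))),
        Finset.mul_sum, Finset.mul_sum]
      simp [pow_succ, mul_smul]

theorem sum_antidiagonal_choose_ad {A : Type*} [Ring A] [Algebra k A] (X : A) (z : ℕ → A)
    (hz : ∀ i, X * z i = z i * X + z (i + 1)) (t : ℕ → A) (t0 : t 0 = 0)
    (ts : ∀ n, t (n + 1) = X * t n + z 0 * X ^ n) (m : ℕ) :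
    t (m + 1) = ∑ ij ∈ Finset.HasAntidiagonal.antidiagonal m,
      (m + 1).choose (ij.1 + 1) • (z ij.1 * X ^ ij.2) := by
  induction m with
  | zero => simp [ts, t0]
  | succ m ih =>
    rw [ts, ih]
    have h1 : ∑ ij ∈ Finset.HasAntidiagonal.antidiagonal (m + 1),
        (m + 1).choose (ij.1 + 1) • (z ij.1 * X ^ ij.2) =
        ∑ ij ∈ Finset.HasAntidiagonal.antidiagonal m,
          (m + 1).choose (ij.1 + 1) • (z ij.1 * X ^ (ij.2 + 1)) := by
      rw [Finset.Nat.sum_antidiagonal_succ']; simp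
    have h2 : ∑ ij ∈ Finset.HasAntidiagonal.antidiagonal (m + 1),
        (m + 1).choose ij.1 • (z ij.1 * X ^ ij.2) =
        z 0 * X ^ (m + 1) + ∑ ij ∈ Finset.HasAntidiagonal.antidiagonal m,
          (m + 1).choose (ij.1 + 1) • (z (ij.1 + 1) * X ^ ij.2) := by
      rw [Finset.Nat.sum_antidiagonal_succ]; simp
    simp only [Nat.choose_succ_succ (m + 1), add_smul, Finset.sum_add_distrib]
    rw [h1, h2, Finset.mul_sum, add_assoc, ← Finset.sum_add_distrib, add_comm]
    congr 1
    refine Finset.sum_congr rfl fun ij _ => ?_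
    rw [← smul_add, mul_smul_comm, ← mul_assoc, hz, add_mul, mul_assoc, ← pow_succ',
      add_comm (z ij.1 * _)]

theorem sum_antidiagonal_assoc {M : Type*} [AddCommMonoid M] (f : ℕ → ℕ → ℕ → M) (n : ℕ) :
    ∑ ij ∈ Finset.HasAntidiagonal.antidiagonal n,
      ∑ ab ∈ Finset.HasAntidiagonal.antidiagonal ij.2, f ij.1 ab.1 ab.2 =
    ∑ ij ∈ Finset.HasAntidiagonal.antidiagonal n,
      ∑ ab ∈ Finset.HasAntidiagonal.antidiagonal ij.1, f ab.1 ab.2 ij.2 := by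
  rw [Finset.sum_sigma', Finset.sum_sigma']
  refine Finset.sum_bij' (fun p _ => ⟨(p.1.1 + p.2.1, p.2.2), (p.1.1, p.2.1)⟩)
    (fun p _ => ⟨(p.2.1, p.2.2 + p.1.2), (p.2.2, p.1.2)⟩) ?_ ?_ ?_ ?_ ?_ <;>
  · rintro ⟨⟨a, b⟩, ⟨c, d⟩⟩ h
    simp only [Finset.mem_sigma, Finset.HasAntidiagonal.mem_antidiagonal] at h
    obtain ⟨rfl, rfl⟩ := h
    simp [add_assoc]

theorem choose_mul_choose_div_eq (i i' l : ℕ) :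
    (((i + (i' + l)).choose i : ℚ) * ((i' + l + 1).choose (i' + 1) / (i' + l + 1 : ℕ))) =
      ((i + i' + l).choose (i + i') : ℚ) * ((i + i').choose i' / (i' + 1)) := by
  rw [show i' + l + 1 = (i' + 1) + l by ring, ← Nat.choose_symm_add (a := i) (b := i'),
    Nat.cast_add_choose, Nat.cast_add_choose, Nat.cast_add_choose, Nat.cast_add_choose,
    show (i' + 1 + l).factorial = (i' + l + 1) * (i' + l).factorial by
      rw [← Nat.factorial_succ]; congr 1; ring, Nat.factorial_succ i', ← add_assoc i]
  have h1 : (i' + l + 1 : ℚ) ≠ 0 := by positivity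
  have h2 : (i' + 1 + l : ℚ) ≠ 0 := by positivity
  have h3 (m : ℕ) : (m.factorial : ℚ) ≠ 0 := Nat.cast_ne_zero.2 m.factorial_ne_zero
  have := h3 i; have := h3 i'; have := h3 l; have := h3 (i + i'); have := h3 (i' + l)
  push_cast
  field_simp
  ring

theorem symmetrization_pow {e : S →ₗ[k] UniversalEnvelopingAlgebra k L}
    [CharZero k] (he : IsSymmetrization k L S ι e) (x : L) (n : ℕ) :
    e (ι x ^ n) = UniversalEnvelopingAlgebra.ι k x ^ n := by
  have h := he (List.replicate n x)
  rw [List.map_replicate, List.prod_replicate] at h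
  rw [h]
  simp only [List.get_eq_getElem, List.getElem_replicate, List.ofFn_const, List.prod_replicate,
    List.length_replicate, Finset.sum_const, Finset.card_univ, Fintype.card_perm,
    Fintype.card_fin]
  rw [← Nat.cast_smul_eq_nsmul k, inv_smul_smul₀ (Nat.cast_ne_zero.2 n.factorial_ne_zero)]

attribute [local instance] LieRing.ofAssociativeRing

theorem ι_mul_ι_eq (x y : L) :
    UniversalEnvelopingAlgebra.ι k x * UniversalEnvelopingAlgebra.ι k y =
      UniversalEnvelopingAlgebra.ι k y * UniversalEnvelopingAlgebra.ι k x +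
        UniversalEnvelopingAlgebra.ι k ⁅x, y⁆ := by
  rw [LieHom.map_lie, LieRing.of_associative_ring_bracket]
  abel

theorem symmetrization_mul_pow [CharZero k] {e : S →ₗ[k] UniversalEnvelopingAlgebra k L}
    (he : IsSymmetrization k L S ι e) (x z : L) (m : ℕ) :
    ((m + 1 : ℕ) : k) • e (ι z * ι x ^ m) =
      ∑ ij ∈ Finset.HasAntidiagonal.antidiagonal m, (m + 1).choose (ij.1 + 1) •
        (UniversalEnvelopingAlgebra.ι k ((LieAlgebra.ad k L x ^ ij.1) z) *
          UniversalEnvelopingAlgebra.ι k x ^ ij.2) := by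
  let X := UniversalEnvelopingAlgebra.ι k x
  let Z := UniversalEnvelopingAlgebra.ι k z
  let t : ℕ → UniversalEnvelopingAlgebra k L := fun n => n.rec 0 fun n u => X * u + Z * X ^ n
  obtain ⟨h, h1, -, -, hs⟩ := exists_pow_add_smul_coeff (k := k) X Z t rfl (fun _ => rfl) (m + 1)
  have key := coeff_mem_of_forall_sum_pow_smul_mem
    (⊥ : Submodule k (UniversalEnvelopingAlgebra k L)) (m + 2)
    (fun i => ((m + 1).choose i : k) • e (ι z ^ i * ι x ^ (m + 1 - i)) - h i) (fun a => by
      rw [Submodule.mem_bot]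
      simp only [smul_sub, Finset.sum_sub_distrib]
      rw [← hs, sub_eq_zero]
      have := symmetrization_pow he (a • z + x) (m + 1)
      rw [map_add, map_smul, add_pow, map_sum, map_add, map_smul] at this
      rw [← this]
      refine Finset.sum_congr rfl fun i _ => ?_
      rw [← map_smul, ← map_smul, smul_pow, smul_mul_assoc, smul_mul_assoc, mul_comm _ (Nat.cast _),
        ← nsmul_eq_mul, Nat.cast_smul_eq_nsmul]) (i := 1) (by omega)
  rw [Submodule.mem_bot, sub_eq_zero, h1, Nat.choose_one_right, pow_one,
    Nat.add_sub_cancel] at key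
  rw [key]
  exact sum_antidiagonal_choose_ad (k := k) X
    (fun i => UniversalEnvelopingAlgebra.ι k ((LieAlgebra.ad k L x ^ i) z))
    (fun i => by rw [ι_mul_ι_eq, pow_succ', Module.End.mul_apply, LieAlgebra.ad_apply]) t rfl
    (fun _ => rfl) m

theorem ι_mul_ι_pow_eq_symmetrization [CharZero k] {e : S →ₗ[k] UniversalEnvelopingAlgebra k L}
    (he : IsSymmetrization k L S ι e) (x y : L) (n : ℕ) :
    UniversalEnvelopingAlgebra.ι k y * UniversalEnvelopingAlgebra.ι k x ^ n =
      e (∑ ij ∈ Finset.HasAntidiagonal.antidiagonal n, (n.choose ij.1 : S) *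
        (ι ((bernoulli ij.1 : k) • (LieAlgebra.ad k L x ^ ij.1) y) * ι x ^ ij.2)) := by
  let G : ℕ → ℕ → UniversalEnvelopingAlgebra k L := fun s l =>
    UniversalEnvelopingAlgebra.ι k ((LieAlgebra.ad k L x ^ s) y) *
      UniversalEnvelopingAlgebra.ι k x ^ l
  have h1 : ∀ i j : ℕ, e ((n.choose i : S) *
      (ι ((bernoulli i : k) • (LieAlgebra.ad k L x ^ i) y) * ι x ^ j)) =
      ∑ ab ∈ Finset.HasAntidiagonal.antidiagonal j,
        ((n.choose i * bernoulli i * ((j + 1).choose (ab.1 + 1) / (j + 1 : ℕ)) : ℚ) : k) •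
          G (i + ab.1) ab.2 := by
    intro i j
    have hj : ((j + 1 : ℕ) : k) ≠ 0 := Nat.cast_ne_zero.2 j.succ_ne_zero
    have h2 := symmetrization_mul_pow he x ((LieAlgebra.ad k L x ^ i) y) j
    rw [← eq_inv_smul_iff₀ hj] at h2
    rw [← nsmul_eq_mul, map_nsmul, map_smul, smul_mul_assoc, map_smul, h2, Finset.smul_sum,
      Finset.smul_sum, Finset.smul_sum]
    refine Finset.sum_congr rfl fun ab _ => ?_
    rw [← Nat.cast_smul_eq_nsmul k, ← Nat.cast_smul_eq_nsmul k, smul_smul, smul_smul, smul_smul,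
      ← Module.End.mul_apply, ← pow_add, add_comm ab.1 i]
    congr 1
    push_cast
    ring
  have h2 : ∀ ij ∈ Finset.HasAntidiagonal.antidiagonal n, e ((n.choose ij.1 : S) *
      (ι ((bernoulli ij.1 : k) • (LieAlgebra.ad k L x ^ ij.1) y) * ι x ^ ij.2)) =
      ∑ ab ∈ Finset.HasAntidiagonal.antidiagonal ij.2,
        ((n.choose ij.1 * bernoulli ij.1 *
          ((ab.1 + ab.2 + 1).choose (ab.1 + 1) / (ab.1 + ab.2 + 1 : ℕ)) : ℚ) : k) •
          G (ij.1 + ab.1) ab.2 := fun ij _ => by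
    rw [h1]
    refine Finset.sum_congr rfl fun ab hab => ?_
    rw [Finset.HasAntidiagonal.mem_antidiagonal.1 hab]
  have h3 : ∀ ij ∈ Finset.HasAntidiagonal.antidiagonal n,
      ∑ ab ∈ Finset.HasAntidiagonal.antidiagonal ij.1,
        ((n.choose ab.1 * bernoulli ab.1 *
          ((ab.2 + ij.2 + 1).choose (ab.2 + 1) / (ab.2 + ij.2 + 1 : ℕ)) : ℚ) : k) •
          G (ab.1 + ab.2) ij.2 = if ij.1 = 0 then G 0 n else 0 := by
    rintro ⟨s, l⟩ hij
    obtain rfl : s + l = n := Finset.HasAntidiagonal.mem_antidiagonal.1 hij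
    have h4 : ∀ ab ∈ Finset.HasAntidiagonal.antidiagonal s,
        (((s + l).choose ab.1 * bernoulli ab.1 *
          ((ab.2 + l + 1).choose (ab.2 + 1) / (ab.2 + l + 1 : ℕ)) : ℚ) : k) •
          G (ab.1 + ab.2) l = ((((s + l).choose s : ℚ) * (((ab.1 + ab.2).choose ab.2 : ℚ) /
            (ab.2 + 1) * bernoulli ab.1) : ℚ) : k) • G s l := by
      rintro ⟨a, b⟩ hab
      obtain rfl : a + b = s := Finset.HasAntidiagonal.mem_antidiagonal.1 hab
      have := choose_mul_choose_div_eq a b l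
      rw [← add_assoc] at this
      rw [mul_right_comm, this]
      congr 2
      ring
    rw [Finset.sum_congr rfl h4, ← Finset.sum_smul, ← Rat.cast_sum, ← Finset.mul_sum,
      bernoulli_spec']
    split_ifs with h <;> simp_all
  rw [map_sum, Finset.sum_congr rfl h2, sum_antidiagonal_assoc fun i a b =>
    ((n.choose i * bernoulli i * ((a + b + 1).choose (a + 1) / (a + b + 1 : ℕ)) : ℚ) : k) •
      G (i + a) b, Finset.sum_congr rfl h3, Finset.sum_eq_single (0, n)]
  · simp [G]
  · rintro ⟨s, l⟩ h hne
    refine if_neg fun hs => hne ?_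
    have := Finset.HasAntidiagonal.mem_antidiagonal.1 h
    simp_all
  · simp

/-- The endomorphism of `S` corresponding to left multiplication in the enveloping algebra. -/
def leftMulOp (E : S ≃ₗ[k] UniversalEnvelopingAlgebra k L) :
    UniversalEnvelopingAlgebra k L →ₐ[k] Module.End k S :=
  (E.symm.conjAlgEquiv k).toAlgHom.comp (Algebra.lmul k (UniversalEnvelopingAlgebra k L))

theorem leftMulOp_apply (E : S ≃ₗ[k] UniversalEnvelopingAlgebra k L)
    (u : UniversalEnvelopingAlgebra k L) (w : S) :
    leftMulOp E u w = E.symm (u * E w) := rfl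

theorem leftMulOp_ι_mem_opOrder [CharZero k] {E : S ≃ₗ[k] UniversalEnvelopingAlgebra k L}
    (hE : IsSymmetrization k L S ι E) (y : L) :
    leftMulOp E (UniversalEnvelopingAlgebra.ι k y) ∈ opOrder ι 1 := by
  refine mem_opOrder_of_iterCommutator_one (iterCommutator_one_mem_of_replicate _ fun n x => ?_)
  rw [iterCommutator_replicate_one x
    (fun i => ι ((bernoulli i : k) • (LieAlgebra.ad k L x ^ i) y)) fun n => ?_]
  · exact ι_mem_Sfil_one _
  · rw [leftMulOp_apply, LinearEquiv.symm_apply_eq]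
    have := symmetrization_pow hE x n
    simp only [LinearEquiv.coe_coe] at this
    rw [this, ι_mul_ι_pow_eq_symmetrization hE]
    rfl

theorem leftMulOp_mem_opOrder [CharZero k] {E : S ≃ₗ[k] UniversalEnvelopingAlgebra k L}
    (hE : IsSymmetrization k L S ι E) {r : ℕ} {w : S} (hw : w ∈ Sdeg k L S ι r) :
    leftMulOp E (E w) ∈ opOrder ι r := by
  have hle : Sdeg k L S ι r ≤
      (opOrder ι r).comap
        ((leftMulOp E).toLinearMap ∘ₗ (E : S →ₗ[k] UniversalEnvelopingAlgebra k L)) := by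
    refine (Sdeg_le_span_pow r).trans (Submodule.span_le.2 ?_)
    rintro _ ⟨x, rfl⟩
    have h1 := symmetrization_pow hE x r
    simp only [LinearEquiv.coe_coe] at h1
    simp only [Submodule.comap_coe, Set.mem_preimage, LinearMap.comp_apply, LinearEquiv.coe_coe,
      h1, AlgHom.toLinearMap_apply, map_pow, SetLike.mem_coe]
    exact pow_mem_opOrder (leftMulOp_ι_mem_opOrder hE x) r
  exact hle hw

theorem iSupIndep_Sdeg [CharZero k] {E : S ≃ₗ[k] UniversalEnvelopingAlgebra k L}
    (hE : IsSymmetrization k L S ι E) :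
    iSupIndep (Sdeg k L S ι) := by
  let δ : L →ₗ⁅k⁆ TensorProduct k (UniversalEnvelopingAlgebra k L)
      (UniversalEnvelopingAlgebra k L) :=
    { toFun := fun x => UniversalEnvelopingAlgebra.ι k x ⊗ₜ[k] 1 +
        1 ⊗ₜ[k] UniversalEnvelopingAlgebra.ι k x
      map_add' := fun x y => by
        simp only [map_add, TensorProduct.add_tmul, TensorProduct.tmul_add]; abel
      map_smul' := fun c x => by
        simp only [map_smul, TensorProduct.smul_tmul', TensorProduct.tmul_smul, smul_add,
          RingHom.id_apply]
      map_lie' := fun {x y} => by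
        simp only [LieHom.map_lie, LieRing.of_associative_ring_bracket, add_mul, mul_add,
          Algebra.TensorProduct.tmul_mul_tmul, one_mul, mul_one,
          TensorProduct.sub_tmul, TensorProduct.tmul_sub]
        abel }
  let ψ : Module.End k S := E.symm.toLinearMap ∘ₗ LinearMap.mul' k (UniversalEnvelopingAlgebra k L) ∘ₗ
    (UniversalEnvelopingAlgebra.lift k δ).toLinearMap ∘ₗ E.toLinearMap
  have h1 : ∀ (x : L) (n : ℕ), ψ (ι x ^ n) = (2 ^ n : k) • ι x ^ n := by
    intro x n
    have h2 := symmetrization_pow hE x n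
    simp only [LinearEquiv.coe_coe] at h2
    simp only [ψ, LinearMap.comp_apply, LinearEquiv.coe_coe, LinearEquiv.symm_apply_eq, map_smul,
      h2, AlgHom.toLinearMap_apply, map_pow]
    have h3 : Commute (UniversalEnvelopingAlgebra.ι k x ⊗ₜ[k] (1 : UniversalEnvelopingAlgebra k L))
        ((1 : UniversalEnvelopingAlgebra k L) ⊗ₜ[k] UniversalEnvelopingAlgebra.ι k x) := by
      simp [commute_iff_eq]
    have h4 : UniversalEnvelopingAlgebra.lift k δ (UniversalEnvelopingAlgebra.ι k x) =
        UniversalEnvelopingAlgebra.ι k x ⊗ₜ[k] 1 +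
        1 ⊗ₜ[k] UniversalEnvelopingAlgebra.ι k x :=
      UniversalEnvelopingAlgebra.lift_ι_apply k δ x
    rw [h4, h3.add_pow, map_sum]
    have h5 : ∀ m ∈ Finset.range (n + 1), LinearMap.mul' k (UniversalEnvelopingAlgebra k L)
        ((UniversalEnvelopingAlgebra.ι k x ⊗ₜ[k] 1) ^ m *
          (1 ⊗ₜ[k] UniversalEnvelopingAlgebra.ι k x) ^ (n - m) * (n.choose m : TensorProduct k _ _))
        = n.choose m • UniversalEnvelopingAlgebra.ι k x ^ n := fun m hm => by
      rw [← (Nat.cast_commute (n.choose m) _).eq, ← nsmul_eq_mul, map_nsmul]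
      simp only [Algebra.TensorProduct.tmul_pow, Algebra.TensorProduct.tmul_mul_tmul, one_pow,
        one_mul, mul_one, LinearMap.mul'_apply, ← pow_add]
      rw [Nat.add_sub_cancel' (Nat.lt_succ_iff.1 (Finset.mem_range.1 hm))]
    rw [Finset.sum_congr rfl h5, ← Finset.sum_smul, Nat.sum_range_choose,
      ← Nat.cast_smul_eq_nsmul k, Nat.cast_pow, Nat.cast_ofNat]
  have h6 : Function.Injective fun n : ℕ => (2 ^ n : k) := fun m n h => by
    have : ((2 ^ m : ℕ) : k) = (2 ^ n : ℕ) := by push_cast; exact h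
    exact Nat.pow_right_injective le_rfl (Nat.cast_injective this)
  refine ((Module.End.eigenspaces_iSupIndep ψ).comp h6).mono fun n =>
    (Sdeg_le_span_pow n).trans (Submodule.span_le.2 ?_)
  rintro _ ⟨x, rfl⟩
  exact Module.End.mem_eigenspace_iff.2 (h1 x n)

theorem exists_counit [CharZero k] {E : S ≃ₗ[k] UniversalEnvelopingAlgebra k L}
    (hE : IsSymmetrization k L S ι E) :
    ∃ ε : UniversalEnvelopingAlgebra k L →ₐ[k] k, ∀ m, 0 < m → ∀ w ∈ Sdeg k L S ι m, ε (E w) = 0 := by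
  refine ⟨UniversalEnvelopingAlgebra.lift k 0, fun m hm w hw => ?_⟩
  have hle : Sdeg k L S ι m ≤ LinearMap.ker
      ((UniversalEnvelopingAlgebra.lift k (0 : L →ₗ⁅k⁆ k)).toLinearMap ∘ₗ E.toLinearMap) := by
    refine (Sdeg_le_span_pow m).trans (Submodule.span_le.2 ?_)
    rintro _ ⟨x, rfl⟩
    have h2 := symmetrization_pow hE x m
    simp only [LinearEquiv.coe_coe] at h2
    simp [h2, hm.ne']
  exact hle hw

theorem component_apply_eq_zero [CharZero k] {E : S ≃ₗ[k] UniversalEnvelopingAlgebra k L}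
    (hE : IsSymmetrization k L S ι E) {B : ℕ → S →ₗ[k] S →ₗ[k] S}
    (hB : IsPBWComponents k L S ι E B) {r m p : ℕ} (hr : 1 ≤ r) (hp : r + m ≤ p) {y w : S}
    (hy : y ∈ Sdeg k L S ι r) (hw : w ∈ Sdeg k L S ι m) : B p y w = 0 := by
  obtain ⟨h1, h2, h3⟩ := hB
  rcases hp.lt_or_eq with hlt | rfl
  · exact h2 p r m hlt y hy w hw
  obtain ⟨ε, hε⟩ := exists_counit hE
  have h4 := h1 (r + m) r m y hy w hw
  rw [Nat.sub_self, Sdeg, pow_zero, Submodule.mem_one] at h4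
  obtain ⟨c, hc⟩ := h4
  have h5 := congrArg ε (h3 r m y hy w hw)
  have hE1 : E 1 = 1 := by simpa using symmetrization_pow hE (0 : L) 0
  simp only [LinearEquiv.coe_coe] at h5
  rw [map_mul, hε r hr y hy, zero_mul, Finset.sum_range_succ, map_add, map_add, map_sum, map_sum,
    Finset.sum_eq_zero fun p hp => hε (r + m - p) (by have := Finset.mem_range.1 hp; omega) _
      (h1 p r m y hy w hw), zero_add, ← hc, Algebra.algebraMap_eq_smul_one, map_smul, map_smul,
      hE1, map_one, smul_eq_mul, mul_one] at h5
  rw [← hc, h5, map_zero]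

theorem iterCommutator_component_eq_zero_of_card_lt [CharZero k]
    {E : S ≃ₗ[k] UniversalEnvelopingAlgebra k L}
    (hE : IsSymmetrization k L S ι E) {B : ℕ → S →ₗ[k] S →ₗ[k] S}
    (hB : IsPBWComponents k L S ι E B) {r p : ℕ} {y : S}
    (hy : y ∈ Sdeg k L S ι r) (s : Multiset L) (hp : p < s.card) :
    iterCommutator ι s (B p y) 1 = 0 := by
  obtain ⟨h1, h2, h3⟩ := hB
  set n := r + s.card with hn
  have hC : iterCommutator ι s (leftMulOp E (E y) - ∑ p ∈ Finset.range (n + 1), B p y) 1 = 0 := by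
    refine iterCommutator_apply_eq_zero (M := s.card) (fun m hm w hw => ?_) s (zero_add _).le
      one_mem_Sdeg_zero
    have h4 : E (∑ p ∈ Finset.range (r + m + 1), B p y w) = E y * E w := h3 r m y hy w hw
    rw [LinearMap.sub_apply, leftMulOp_apply, sub_eq_zero, ← h4, LinearEquiv.symm_apply_apply,
      LinearMap.sum_apply]
    refine Finset.sum_subset (Finset.range_subset_range.2 (by omega)) fun p _ hp => ?_
    exact h2 p r m (by simpa using hp) y hy w hw
  have hA : ∑ p ∈ Finset.range (n + 1), iterCommutator ι s (B p y) 1 ∈ Sfil ι r := by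
    rw [map_sub, LinearMap.sub_apply, sub_eq_zero, map_sum, LinearMap.sum_apply] at hC
    rw [← hC]
    have := leftMulOp_mem_opOrder hE hy s 0 1 (Sdeg_le_Sfil 0 one_mem_Sdeg_zero)
    rwa [zero_add] at this
  have ha : ∀ p, iterCommutator ι s (B p y) 1 ∈ Sdeg k L S ι (n - p) := fun p =>
    iterCommutator_apply_mem_Sdeg (fun m w hw => h1 p r m y hy w hw)
      (fun m hm w hw => h2 p r m hm y hy w hw) s one_mem_Sdeg_zero
  obtain ⟨v, hv, hv0, hvs⟩ := exists_homogeneous_of_mem_Sfil hA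
  rw [← Finset.sum_range_reflect] at hvs
  have key := (iSupIndep_iff_finsetSum_eq_imp_eq _).1 (iSupIndep_Sdeg hE) (Finset.range (n + 1)) v
    (fun i => iterCommutator ι s (B (n + 1 - 1 - i) y) 1)
    (fun i hi => ⟨hv i, by
      have := ha (n + 1 - 1 - i)
      rwa [show n - (n + 1 - 1 - i) = i by have := Finset.mem_range.1 hi; omega] at this⟩)
    (hvs _ (by omega)) (n - p) (Finset.mem_range.2 (by omega))
  rw [hv0 _ (by omega)] at key
  rw [key, show n + 1 - 1 - (n - p) = p by omega]

theorem iterCommutator_component_eq_zero_of_add_le [CharZero k]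
    {E : S ≃ₗ[k] UniversalEnvelopingAlgebra k L}
    (hE : IsSymmetrization k L S ι E) {B : ℕ → S →ₗ[k] S →ₗ[k] S}
    (hB : IsPBWComponents k L S ι E B) {r p : ℕ} (hr : 1 ≤ r) {y : S}
    (hy : y ∈ Sdeg k L S ι r) (s : Multiset L) (hp : s.card + r ≤ p) :
    iterCommutator ι s (B p y) 1 = 0 :=
  iterCommutator_apply_eq_zero (M := s.card)
    (fun _ hm _ hw => component_apply_eq_zero hE hB hr (by omega) hy hw) s (zero_add _).le
    one_mem_Sdeg_zero

theorem sum_paperC_mul_choose (q : ℕ) {i r : ℕ} (hi : i < r) :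
    ∑ c ∈ Finset.range r, paperC q c * ((q + i).choose (q + c) : ℚ) = 1 := by
  have h1 : ∑ c ∈ Finset.range (i + 1), paperC q c * ((q + i).choose (q + c) : ℚ) = 1 := by
    rw [Finset.sum_range_succ, Nat.choose_self, Nat.cast_one, mul_one]
    rcases i with _ | i
    · simp [paperC]
    · rw [paperC.eq_2, Fin.sum_univ_eq_sum_range
        fun l => paperC q l * ((q + (i + 1)).choose (i + 1 - l) : ℚ), add_sub_assoc', sub_eq_iff_eq_add,
        add_comm]
      congr 1
      refine Finset.sum_congr rfl fun c hc => ?_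
      have := Finset.mem_range.1 hc
      rw [← Nat.choose_symm (by omega : q + c ≤ q + (i + 1)), Nat.add_sub_add_left]
  rw [← h1]
  refine (Finset.sum_subset (Finset.range_subset_range.2 hi) fun c _ hc => ?_).symm
  rw [Nat.choose_eq_zero_of_lt (by simp at hc; omega), Nat.cast_zero, mul_zero]

end SymmetricAlgebraModel

/-- Lemma 2.0 of the paper, symmetric version: for `p ≥ 1`, `q ≥ 0`, `r ≥ 1` and
`x_1,…,x_{p+q}, y_1,…,y_r ∈ 𝔤`,
`B_p(y_1⋯y_r, x_1⋯x_{p+q}) = ∑_{k=0}^{r-1} c_k(q) ∑_{#S = q+k} x_S B_p(y_1⋯y_r, x_{S^c})`,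
the inner sum being over subsets `S ⊆ {1,…,p+q}` of cardinality `q+k`. -/
theorem lemma_2_0_symm (k : Type) [Field k] [CharZero k]
    (L : Type) [LieRing L] [LieAlgebra k L]
    (S : Type) [CommRing S] [Algebra k S] (ι : L →ₗ[k] S)
    (hS : IsSymmAlg k L S ι)
    (e : S →ₗ[k] UniversalEnvelopingAlgebra k L)
    (he : IsSymmetrization k L S ι e) (hbij : Function.Bijective e)
    (B : ℕ → S →ₗ[k] S →ₗ[k] S) (hB : IsPBWComponents k L S ι e B)
    (p q r : ℕ) (hp : 1 ≤ p) (hr : 1 ≤ r)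
    (x : Fin (p + q) → L) (y : Fin r → L) :
    B p (∏ j, ι (y j)) (∏ i, ι (x i)) =
      ∑ c ∈ Finset.range r, ((paperC q c : ℚ) : k) •
        ∑ T ∈ Finset.powersetCard (q + c) (Finset.univ : Finset (Fin (p + q))),
          (∏ i ∈ T, ι (x i)) * B p (∏ j, ι (y j)) (∏ i ∈ Tᶜ, ι (x i)) := by
  classical
  have hE : IsSymmetrization k L S ι (LinearEquiv.ofBijective e hbij : S ≃ₗ[k] _) := he
  have hB' : IsPBWComponents k L S ι (LinearEquiv.ofBijective e hbij : S ≃ₗ[k] _) B := hB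
  have hy := prod_mem_Sdeg (ι := ι) y
  set Y := ∏ j, ι (y j)
  let a : Finset (Fin (p + q)) → S := fun V =>
    iterCommutator ι (V.val.map x) (B p Y) 1
  have hexp : ∀ T : Finset (Fin (p + q)), B p Y (∏ i ∈ T, ι (x i)) =
      ∑ V ∈ T.powerset, (∏ i ∈ T \ V, ι (x i)) * a V := fun T => by
    have := apply_prod_mul_eq_sum_iterCommutator (ι := ι) x T (B p Y) 1
    rwa [mul_one] at this
  have hinner : ∀ n, ∑ T ∈ Finset.powersetCard n (Finset.univ : Finset (Fin (p + q))),
      (∏ i ∈ T, ι (x i)) * B p Y (∏ i ∈ Tᶜ, ι (x i)) =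
      ∑ V : Finset (Fin (p + q)),
        ((p + q - V.card).choose n : k) • ((∏ i ∈ Vᶜ, ι (x i)) * a V) := by
    intro n
    have h1 : ∀ T ∈ Finset.powersetCard n (Finset.univ : Finset (Fin (p + q))),
        (∏ i ∈ T, ι (x i)) * B p Y (∏ i ∈ Tᶜ, ι (x i)) =
        ∑ V ∈ Tᶜ.powerset, (∏ i ∈ Vᶜ, ι (x i)) * a V := fun T _ => by
      rw [hexp, Finset.mul_sum]
      refine Finset.sum_congr rfl fun V hV => ?_
      have hTV : T ⊆ Vᶜ := Finset.subset_compl_comm.1 (Finset.mem_powerset.1 hV)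
      have hsd : Tᶜ \ V = Vᶜ \ T := by ext i; simp [and_comm]
      rw [hsd, ← mul_assoc, mul_comm (∏ i ∈ T, _), Finset.prod_sdiff hTV]
    rw [Finset.sum_congr rfl h1, Finset.sum_comm' (t' := Finset.univ)
      (s' := fun V => Finset.powersetCard n Vᶜ) fun T V => by
        simp [Finset.mem_powersetCard, Finset.subset_compl_comm (s := T), and_comm]]
    refine Finset.sum_congr rfl fun V _ => ?_
    rw [Finset.sum_const, Finset.card_powersetCard, Finset.card_compl, Fintype.card_fin,
      Nat.cast_smul_eq_nsmul]
  simp only [hinner, Finset.smul_sum]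
  rw [hexp, Finset.sum_comm, Finset.powerset_univ]
  refine Finset.sum_congr rfl fun V _ => ?_
  rw [← Finset.compl_eq_univ_sdiff]
  have hcard : (V.val.map x).card = V.card := Multiset.card_map _ _
  by_cases hV : V.card ≤ p ∧ p < V.card + r
  · obtain ⟨i, hi⟩ := Nat.exists_eq_add_of_le hV.1
    simp only [smul_smul, ← Finset.sum_smul]
    have hsub : p + q - V.card = q + i := by omega
    rw [hsub]
    have hc := sum_paperC_mul_choose q (i := i) (r := r) (by omega)
    have hck := congrArg (fun z : ℚ => (z : k)) hc
    push_cast at hck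
    rw [hck, one_smul]
  · have ha : a V = 0 := by
      rcases lt_or_ge p V.card with h | h
      · exact iterCommutator_component_eq_zero_of_card_lt hE hB' hy _
          (hcard ▸ h)
      · exact iterCommutator_component_eq_zero_of_add_le hE hB' hr hy _
          (by omega)
    simp [ha]

end
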